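/- The function P(c_0, ..., c_n) := Φ(Π_{i=0}^{n} y_i^{c_i}) / n!, defined on (n+1)-tuples of nonnegative integers with Σ c_i = n, satisfies: (i) P(1, 1, ..., 1, 0) = 1; (ii) P(c_0, ..., c_n) = 0 whenever c_n > 0; and (iii) for every tuple c and every index k (indices modulo n+1) with c_k ≥ 2, 2·P(c) = P(c with c_{k−1} increased by 1, c_k decreased by 1) + P(c with c_k decreased by 1, c_{k+1} increased by 1). Here G is the path on the ordered variable set V = {x_0, ..., x_n}, Φ = DS_G, and y_i = x_0 + ... + x_i. -/

import Mathlib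

open MvPolynomial

/-- Partial divided symmetrization of a polynomial `f` over the graph on the variables
`x_0 < x_1 < ... < x_{m-1}` whose (ordered) edges form the finset `E`:
`DS_G(f) = Σ_π (f ∘ π) / Π_{(x,y) ∈ E} (x_π − y_π)`,
the sum being over all `m!` permutations of the variables. -/
noncomputable def DS {K : Type*} [Field K] {m : ℕ} (E : Finset (Fin m × Fin m))
    (f : MvPolynomial (Fin m) K) : FractionRing (MvPolynomial (Fin m) K) :=
  ∑ π : Equiv.Perm (Fin m),
    algebraMap (MvPolynomial (Fin m) K) (FractionRing (MvPolynomial (Fin m) K))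
        (rename (⇑π) f) /
      algebraMap (MvPolynomial (Fin m) K) (FractionRing (MvPolynomial (Fin m) K))
        (rename (⇑π) (∏ e ∈ E, (X e.1 - X e.2)))

/-- The edge set of the path `x_0 — x_1 — ⋯ — x_n`: the pairs `(x_i, x_{i+1})`,
`0 ≤ i ≤ n−1`. -/
def pathEdges (n : ℕ) : Finset (Fin (n + 1) × Fin (n + 1)) :=
  Finset.univ.image fun i : Fin n => (i.castSucc, i.succ)

/-- `pathY n K k = y_k = x_0 + x_1 + ⋯ + x_k`. -/
noncomputable def pathY (n : ℕ) (K : Type*) [Field K] (k : Fin (n + 1)) :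
    MvPolynomial (Fin (n + 1)) K :=
  ∑ j ∈ Finset.Iic k, X j

/-- The sum of the first `j` variables among `x_0, …, x_{m-1}`. -/
noncomputable def sumFirst (m : ℕ) (L : Type*) [Field L] (j : ℕ) : MvPolynomial (Fin m) L :=
  ∑ i : Fin m with i.val < j, X i

/-- The linear factor `x_i - x_j` if `i` and `j` lie in the same block of `b`, and otherwise the
sign recording the order of the two blocks. -/
noncomputable def blockDiff {m : ℕ} (b : Fin m → ℕ) (L : Type*) [Field L] (i j : Fin m) :
    MvPolynomial (Fin m) L :=
  if b i = b j then X i - X j else if b i < b j then 1 else -1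

/-- The permutations preserving each block of `b`. -/
def blockPerms {m : ℕ} (b : Fin m → ℕ) : Finset (Equiv.Perm (Fin m)) :=
  Finset.univ.filter fun σ => b ∘ σ = b

lemma mem_blockPerms {m : ℕ} {b : Fin m → ℕ} {σ : Equiv.Perm (Fin m)} :
    σ ∈ blockPerms b ↔ b ∘ σ = b := by
  simp [blockPerms]

/-- Divided symmetrization over the path, evaluated at a point `x`. -/
noncomputable def pathSym {L : Type*} [Field L] {n : ℕ} (x : Fin (n + 1) → L) :
    MvPolynomial (Fin (n + 1)) L →ₗ[L] L :=
  ∑ π : Equiv.Perm (Fin (n + 1)),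
    (∏ i : Fin n, (x (π i.castSucc) - x (π i.succ)))⁻¹ • (aeval (x ∘ π)).toLinearMap

section Vanishing

variable {L : Type*} [Field L]

lemma blockDiff_antisymm {m : ℕ} (b : Fin m → ℕ) (i j : Fin m) :
    blockDiff b L i j = -blockDiff b L j i := by
  unfold blockDiff
  rcases lt_trichotomy (b i) (b j) with h | h | h
  · simp [h, h.ne, h.ne', h.not_gt]
  · simp [h]
  · simp [h, h.ne, h.ne', h.not_gt]

lemma rename_blockDiff {m : ℕ} (b : Fin m → ℕ) {σ : Equiv.Perm (Fin m)} (hσ : b ∘ σ = b)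
    (i j : Fin m) : rename σ (blockDiff b L i j) = blockDiff b L (σ i) (σ j) := by
  have h : ∀ i, b (σ i) = b i := fun i => congrFun hσ i
  unfold blockDiff
  simp only [h]
  split_ifs <;> simp

lemma totalDegree_blockDiff_le {m : ℕ} (b : Fin m → ℕ) (i j : Fin m) :
    (blockDiff b L i j).totalDegree ≤ if b i = b j then 1 else 0 := by
  unfold blockDiff
  split_ifs
  · exact (totalDegree_sub _ _).trans (by simp)
  · simp
  · simp

lemma eval_blockDiff_ne_zero {m : ℕ} (b : Fin m → ℕ) {x : Fin m → L}
    (hx : Function.Injective x) {i j : Fin m} (hij : i ≠ j) :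
    eval x (blockDiff b L i j) ≠ 0 := by
  unfold blockDiff
  split_ifs
  · simpa [sub_eq_zero] using hx.ne hij
  · simp
  · simp

lemma rename_prod_blockDiff {m : ℕ} (b : Fin m → ℕ) {σ : Equiv.Perm (Fin m)}
    (hσ : b ∘ σ = b) :
    rename σ (∏ p : Fin m × Fin m with p.1 < p.2, blockDiff b L p.1 p.2) =
      (σ.sign : MvPolynomial (Fin m) L) *
        ∏ p : Fin m × Fin m with p.1 < p.2, blockDiff b L p.1 p.2 := by
  have key : ∀ F : Fin m → Fin m → MvPolynomial (Fin m) L,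
      ∏ p : Fin m × Fin m with p.1 < p.2, F p.1 p.2 = ∏ j, ∏ i ∈ Finset.Iio j, F i j := by
    intro F
    rw [Finset.prod_filter, Fintype.prod_prod_type_right]
    refine Finset.prod_congr rfl fun j _ => ?_
    rw [← Finset.prod_filter]
    exact Finset.prod_congr (by ext; simp) fun _ _ => rfl
  rw [map_prod]
  simp only [rename_blockDiff b hσ]
  rw [key fun i j => blockDiff b L (σ i) (σ j), key,
    σ.prod_Iio_comp_eq_sign_mul_prod (blockDiff_antisymm b)]

/-- The number of same-block pairs is at most the sum of any family of naturals that is injective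
on each block. -/
lemma card_blockPairs_le_sum {m : ℕ} (b d : Fin m → ℕ)
    (hd : ∀ i j, i ≠ j → b i = b j → d i ≠ d j) :
    (Finset.univ.filter fun p : Fin m × Fin m => p.1 < p.2 ∧ b p.1 = b p.2).card ≤ ∑ i, d i := by
  have h1 : (Finset.univ.filter fun p : Fin m × Fin m => p.1 < p.2 ∧ b p.1 = b p.2).card ≤
      (Finset.univ.filter fun p : Fin m × Fin m => d p.1 < d p.2 ∧ b p.1 = b p.2).card := by
    refine Finset.card_le_card_of_injOn (fun p => if d p.1 < d p.2 then p else p.swap) ?_ ?_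
    · rintro ⟨i, j⟩ h
      simp only [Finset.coe_filter, Finset.mem_univ, true_and, Set.mem_ofPred_eq] at h ⊢
      have := hd i j h.1.ne h.2
      split_ifs with h'
      · exact ⟨h', h.2⟩
      · exact ⟨by simp only [Prod.fst_swap, Prod.snd_swap]; omega, h.2.symm⟩
    · rintro ⟨i, j⟩ h ⟨i', j'⟩ h' heq
      simp only [Finset.coe_filter, Finset.mem_univ, true_and, Set.mem_ofPred_eq] at h h' heq
      split_ifs at heq <;> simp only [Prod.swap_prod_mk, Prod.mk.injEq] at heq ⊢ <;>
        obtain ⟨rfl, rfl⟩ := heq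
      · exact ⟨rfl, rfl⟩
      · exact absurd h.1 h'.1.not_gt
      · exact absurd h.1 h'.1.not_gt
      · exact ⟨rfl, rfl⟩
  refine h1.trans ?_
  rw [Finset.card_eq_sum_card_fiberwise (f := Prod.snd) (t := Finset.univ) (by simp)]
  refine Finset.sum_le_sum fun j _ => ?_
  rw [← Finset.card_range (d j)]
  refine Finset.card_le_card_of_injOn (fun p => d p.1) ?_ ?_
  · rintro ⟨i, k⟩ h
    simp only [Finset.coe_filter, Finset.mem_filter, Finset.mem_univ, true_and,
      Set.mem_ofPred_eq] at h
    simpa [← h.2] using h.1.1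
  · rintro ⟨i, k⟩ h ⟨i', k'⟩ h' heq
    simp only [Finset.coe_filter, Finset.mem_filter, Finset.mem_univ, true_and,
      Set.mem_ofPred_eq] at h h' heq
    obtain ⟨⟨-, hb⟩, rfl⟩ := h
    obtain ⟨⟨-, hb'⟩, rfl⟩ := h'
    by_contra hne
    exact hd i i' (fun e => hne (by rw [e])) (hb.trans hb'.symm) heq

/-- The block-wise antisymmetrization of a polynomial whose degree is smaller than that of the
product of the block Vandermonde polynomials is zero. -/
lemma antisymmetrization_eq_zero [CharZero L] {m : ℕ} (b : Fin m → ℕ)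
    (f : MvPolynomial (Fin m) L)
    (hf : f.totalDegree <
      (Finset.univ.filter fun p : Fin m × Fin m => p.1 < p.2 ∧ b p.1 = b p.2).card) :
    ∑ σ ∈ blockPerms b,
      (σ.sign : MvPolynomial (Fin m) L) * rename σ f = 0 := by
  set A := ∑ σ ∈ blockPerms b,
      (σ.sign : MvPolynomial (Fin m) L) * rename σ f with hA
  have hdeg : A.totalDegree ≤ f.totalDegree := by
    refine totalDegree_finsetSum_le fun σ _ => ?_
    refine (totalDegree_mul _ _).trans ?_
    have : ((σ.sign : ℤ) : MvPolynomial (Fin m) L).totalDegree = 0 := by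
      rw [← map_intCast (C : L →+* MvPolynomial (Fin m) L), totalDegree_C]
    rw [this, zero_add]
    exact totalDegree_rename_le _ _
  have halt : ∀ i j, i ≠ j → b i = b j → rename (Equiv.swap i j) A = -A := by
    intro i j hij hb
    have hsw : ∀ k, b (Equiv.swap i j k) = b k := by
      intro k
      rw [Equiv.swap_apply_def]
      split_ifs with h1 h2
      · rw [h1, hb]
      · rw [h2, hb]
      · rfl
    rw [hA, map_sum, ← Finset.sum_neg_distrib]
    refine Finset.sum_bij' (fun σ _ => Equiv.swap i j * σ) (fun σ _ => Equiv.swap i j * σ)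
      ?_ ?_ ?_ ?_ ?_
    · intro σ hσ
      simp only [mem_blockPerms, _root_.funext_iff, Function.comp_apply,
        Equiv.Perm.mul_apply, hsw] at hσ ⊢
      exact hσ
    · intro σ hσ
      simp only [mem_blockPerms, _root_.funext_iff, Function.comp_apply,
        Equiv.Perm.mul_apply, hsw] at hσ ⊢
      exact hσ
    · intro σ _
      simp
    · intro σ _
      simp
    · intro σ _
      rw [map_mul, map_intCast, rename_rename, Equiv.Perm.sign_mul, Equiv.Perm.sign_swap hij,
        Equiv.Perm.coe_mul]
      simp
  ext d
  rw [coeff_zero]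
  by_cases hd : ∀ i j, i ≠ j → b i = b j → d i ≠ d j
  · apply coeff_eq_zero_of_totalDegree_lt
    refine lt_of_le_of_lt hdeg (hf.trans_le ((card_blockPairs_le_sum b d hd).trans ?_))
    rw [Finset.sum_subset (Finset.subset_univ d.support) (by simp)]
  · push Not at hd
    obtain ⟨i, j, hij, hb, hdij⟩ := hd
    have h1 := coeff_rename_mapDomain (Equiv.swap i j) (Equiv.injective _) A d
    have h2 : d.mapDomain (Equiv.swap i j) = d := by
      rw [← Finsupp.equivMapDomain_eq_mapDomain]
      ext k
      rw [Finsupp.equivMapDomain_apply, Equiv.symm_swap, Equiv.swap_apply_def]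
      split_ifs with h1 h2
      · rw [h1, hdij]
      · rw [h2, hdij]
      · rfl
    rw [h2, halt i j hij hb, coeff_neg] at h1
    exact self_eq_neg.mp h1.symm

lemma sum_block_div_eq_zero [CharZero L] {m : ℕ} (b : Fin m → ℕ) (E : Finset (Fin m × Fin m))
    (hE : ∀ e ∈ E, e.1 < e.2 ∧ b e.1 = b e.2) (g : MvPolynomial (Fin m) L)
    (hg : g.totalDegree < E.card) {x : Fin m → L} (hx : Function.Injective x) :
    ∑ σ ∈ blockPerms b,
      eval (x ∘ σ) g / ∏ e ∈ E, (x (σ e.1) - x (σ e.2)) = 0 := by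
  classical
  set P := Finset.univ.filter fun p : Fin m × Fin m => p.1 < p.2 with hP
  have hEP : E ⊆ P := fun e he => by simpa [hP] using (hE e he).1
  set D := ∏ p ∈ P, blockDiff b L p.1 p.2 with hD
  set D' := ∏ p ∈ P \ E, blockDiff b L p.1 p.2 with hD'
  have hDD : D = D' * ∏ e ∈ E, (X e.1 - X e.2) := by
    rw [hD, hD', ← Finset.prod_sdiff hEP]
    congr 1
    refine Finset.prod_congr rfl fun e he => ?_
    rw [blockDiff, if_pos (hE e he).2]
  have hD0 : ∀ y : Fin m → L, Function.Injective y → eval y D ≠ 0 := by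
    intro y hy
    rw [hD, map_prod, Finset.prod_ne_zero_iff]
    intro p hp
    exact eval_blockDiff_ne_zero b hy (by simpa [hP] using hp : p.1 < p.2).ne
  have hdeg : (g * D').totalDegree <
      (Finset.univ.filter fun p : Fin m × Fin m => p.1 < p.2 ∧ b p.1 = b p.2).card := by
    have h1 : D'.totalDegree ≤ ((P \ E).filter fun p => b p.1 = b p.2).card := by
      rw [Finset.card_filter]
      exact (totalDegree_finsetProd _ _).trans
        (Finset.sum_le_sum fun p _ => totalDegree_blockDiff_le b p.1 p.2)
    have h2 : ((P \ E).filter fun p => b p.1 = b p.2) =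
        (Finset.univ.filter fun p : Fin m × Fin m => p.1 < p.2 ∧ b p.1 = b p.2) \ E := by
      ext p
      simp only [hP, Finset.mem_filter, Finset.mem_sdiff, Finset.mem_univ, true_and]
      tauto
    have h3 : E ⊆ Finset.univ.filter fun p : Fin m × Fin m => p.1 < p.2 ∧ b p.1 = b p.2 :=
      fun e he => by simpa using hE e he
    rw [h2] at h1
    have h4 := Finset.card_sdiff_add_card_eq_card h3
    have h5 := totalDegree_mul g D'
    omega
  have hA := congrArg (eval x) (antisymmetrization_eq_zero b (g * D') hdeg)
  rw [map_zero, map_sum] at hA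
  suffices h : ∑ σ ∈ blockPerms b,
      eval (x ∘ σ) g / ∏ e ∈ E, (x (σ e.1) - x (σ e.2)) =
      (∑ σ ∈ blockPerms b,
        eval x ((σ.sign : MvPolynomial (Fin m) L) * rename σ (g * D'))) / eval x D by
    rw [h, hA, zero_div]
  rw [Finset.sum_div]
  refine Finset.sum_congr rfl fun σ hσ => ?_
  have hσ' : b ∘ σ = b := mem_blockPerms.mp hσ
  have hy : Function.Injective (x ∘ σ) := hx.comp σ.injective
  have hren := congrArg (eval x) (rename_prod_blockDiff (L := L) b hσ')
  rw [eval_rename, map_mul, map_intCast] at hren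
  have hDy := hD0 _ hy
  have hprod : eval (x ∘ σ) (∏ e ∈ E, (X e.1 - X e.2)) =
      ∏ e ∈ E, (x (σ e.1) - x (σ e.2)) := by
    simp [map_prod]
  have hsplit : eval (x ∘ σ) D = eval (x ∘ σ) D' * ∏ e ∈ E, (x (σ e.1) - x (σ e.2)) := by
    rw [hDD, map_mul, hprod]
  rw [map_mul, map_intCast, eval_rename, map_mul,
    div_eq_div_iff (right_ne_zero_of_mul (hsplit ▸ hDy)) (hD0 x hx)]
  change eval (x ∘ σ) D = ((σ.sign : ℤ) : L) * eval x D at hren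
  have hs : ((σ.sign : ℤ) : L) * ((σ.sign : ℤ) : L) = 1 := by
    rcases Int.units_eq_one_or σ.sign with h | h <;> simp [h]
  linear_combination (eval (x ∘ σ) g * ((σ.sign : ℤ) : L)) * (hsplit - hren) -
    eval (x ∘ σ) g * eval x D * hs

/-- Averaging a sum over a finite group along a finite family of right translations. -/
lemma card_mul_sum_eq {G ι : Type*} [Group G] [Fintype G] (s : Finset ι) (h : ι → G)
    (T : G → L) : (s.card : L) * ∑ π, T π = ∑ π, ∑ σ ∈ s, T (π * h σ) := by
  rw [Finset.sum_comm, ← nsmul_eq_mul, ← Finset.sum_const]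
  exact Finset.sum_congr rfl fun σ _ => (Equiv.sum_comp (Equiv.mulRight (h σ)) T).symm

lemma sum_div_eq_zero [CharZero L] {m : ℕ} (b : Fin m → ℕ) (E : Finset (Fin m × Fin m))
    (hE : ∀ e ∈ E, e.1 < e.2 ∧ b e.1 = b e.2) (s g : MvPolynomial (Fin m) L)
    (hs : ∀ σ : Equiv.Perm (Fin m), b ∘ σ = b → rename σ s = s)
    (hg : g.totalDegree < E.card) {x : Fin m → L} (hx : Function.Injective x) :
    ∑ π : Equiv.Perm (Fin m),
      eval (x ∘ π) (s * g) / ∏ e ∈ E, (x (π e.1) - x (π e.2)) = 0 := by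
  have h := card_mul_sum_eq (blockPerms b) id
    fun π : Equiv.Perm (Fin m) => eval (x ∘ π) (s * g) / ∏ e ∈ E, (x (π e.1) - x (π e.2))
  have hpos : ((blockPerms b).card : L) ≠ 0 := by
    rw [Nat.cast_ne_zero, Finset.card_ne_zero]
    exact ⟨1, mem_blockPerms.mpr rfl⟩
  refine (mul_eq_zero.mp (h.trans (Finset.sum_eq_zero fun π _ => ?_))).resolve_left hpos
  have h0 := sum_block_div_eq_zero b E hE g hg (hx.comp π.injective)
  rw [← mul_zero (eval (x ∘ π) s), ← h0, Finset.mul_sum]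
  refine Finset.sum_congr rfl fun σ hσ => ?_
  have hs' : eval (x ∘ π ∘ σ) s = eval (x ∘ π) s := by
    conv_rhs => rw [← hs σ (mem_blockPerms.mp hσ), eval_rename]
    rfl
  simp only [id, Equiv.Perm.coe_mul, map_mul, hs', Function.comp_apply, mul_div_assoc,
    Function.comp_assoc]

end Vanishing

section PathSym

variable {L : Type*} [Field L]

lemma pathSym_apply {n : ℕ} (x : Fin (n + 1) → L) (g : MvPolynomial (Fin (n + 1)) L) :
    pathSym x g = ∑ π : Equiv.Perm (Fin (n + 1)),
      eval (x ∘ π) g / ∏ i : Fin n, (x (π i.castSucc) - x (π i.succ)) := by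
  simp [pathSym, div_eq_inv_mul]

lemma sumFirst_zero (m : ℕ) : sumFirst m L 0 = 0 := by
  simp [sumFirst]

lemma sumFirst_succ {m j : ℕ} (hj : j < m) :
    sumFirst m L (j + 1) = sumFirst m L j + X ⟨j, hj⟩ := by
  have : (Finset.univ.filter fun i : Fin m => i.val < j + 1) =
      insert ⟨j, hj⟩ (Finset.univ.filter fun i : Fin m => i.val < j) := by
    ext i
    simp only [Finset.mem_filter, Finset.mem_univ, true_and, Finset.mem_insert, Fin.ext_iff]
    omega
  rw [sumFirst, sumFirst, this, Finset.sum_insert (by simp), add_comm]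

lemma totalDegree_sumFirst_le (m j : ℕ) : (sumFirst m L j).totalDegree ≤ 1 :=
  totalDegree_finsetSum_le fun i _ => by simp

lemma rename_castSucc_sumFirst {m j : ℕ} (hj : j ≤ m) :
    rename Fin.castSucc (sumFirst m L j) = sumFirst (m + 1) L j := by
  induction j with
  | zero => simp [sumFirst_zero]
  | succ j ih =>
    rw [sumFirst_succ (by omega : j < m), sumFirst_succ (by omega : j < m + 1), map_add,
      ih (by omega), rename_X]
    rfl

lemma rename_sumFirst {m j : ℕ} (b : Fin m → ℕ) (hb : ∀ i, i.val < j ↔ b i = 0)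
    (σ : Equiv.Perm (Fin m)) (hσ : b ∘ σ = b) :
    rename σ (sumFirst m L j) = sumFirst m L j := by
  simp only [sumFirst, map_sum, rename_X]
  refine Finset.sum_equiv σ (fun i => ?_) fun i _ => rfl
  simp only [Finset.mem_filter, Finset.mem_univ, true_and, hb]
  rw [show b (σ i) = b i from congrFun hσ i]

lemma pathSym_sumFirst_last_mul [CharZero L] {n : ℕ} {x : Fin (n + 1) → L}
    (hx : Function.Injective x) {g : MvPolynomial (Fin (n + 1)) L} (hg : g.totalDegree < n) :
    pathSym x (sumFirst (n + 1) L (n + 1) * g) = 0 := by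
  have hinj : Function.Injective fun i : Fin n => (i.castSucc, i.succ) :=
    fun i j h => Fin.castSucc_injective _ (Prod.ext_iff.mp h).1
  have h := sum_div_eq_zero (fun _ => 0) (Finset.univ.map ⟨_, hinj⟩) (by simp)
    (sumFirst (n + 1) L (n + 1)) g (rename_sumFirst _ fun i => by simp [i.is_le])
    (by simpa using hg) hx
  simpa [pathSym_apply] using h

lemma pathSym_sub_mul {n : ℕ} {x : Fin (n + 1) → L} (hx : Function.Injective x) (k : Fin n)
    (g : MvPolynomial (Fin (n + 1)) L) :
    pathSym x ((X k.castSucc - X k.succ) * g) = ∑ π : Equiv.Perm (Fin (n + 1)),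
      eval (x ∘ π) g / ∏ i ∈ Finset.univ.erase k, (x (π i.castSucc) - x (π i.succ)) := by
  rw [pathSym_apply]
  refine Finset.sum_congr rfl fun π _ => ?_
  have h0 : x (π k.castSucc) - x (π k.succ) ≠ 0 :=
    sub_ne_zero.mpr (hx.ne (π.injective.ne (Fin.castSucc_lt_succ (i := k)).ne))
  rw [← Finset.mul_prod_erase _ _ (Finset.mem_univ k), map_mul]
  simp only [map_sub, eval_X, Function.comp_apply]
  rw [mul_div_mul_left _ _ h0]

lemma pathSym_sub_mul_sumFirst_mul [CharZero L] {n : ℕ} {x : Fin (n + 1) → L}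
    (hx : Function.Injective x) (k : Fin n) {g : MvPolynomial (Fin (n + 1)) L}
    (hg : g.totalDegree + 1 < n) :
    pathSym x ((X k.castSucc - X k.succ) * (sumFirst (n + 1) L (k + 1) * g)) = 0 := by
  have hinj : Function.Injective fun i : Fin n => (i.castSucc, i.succ) :=
    fun i j h => Fin.castSucc_injective _ (Prod.ext_iff.mp h).1
  have h := sum_div_eq_zero (fun i : Fin (n + 1) => if i.val < k + 1 then 0 else 1)
    ((Finset.univ.erase k).map ⟨_, hinj⟩) (by
      intro e he
      obtain ⟨i, hi, rfl⟩ := Finset.mem_map.mp he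
      have hik : i.val ≠ k.val := fun h => Finset.ne_of_mem_erase hi (Fin.ext h)
      refine ⟨Fin.castSucc_lt_succ, ?_⟩
      simp only [Function.Embedding.coeFn_mk, Fin.val_castSucc, Fin.val_succ]
      split_ifs <;> omega)
    (sumFirst (n + 1) L (k + 1)) g (rename_sumFirst _ fun i => by simp)
    (by rw [Finset.card_map, Finset.card_erase_of_mem (Finset.mem_univ k), Finset.card_univ,
      Fintype.card_fin]; omega) hx
  rw [pathSym_sub_mul hx]
  simpa only [Finset.prod_map, Function.Embedding.coeFn_mk] using h

lemma pathSym_sub_last_mul_rename [CharZero L] {n : ℕ} {x : Fin (n + 2) → L}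
    (hx : Function.Injective x) (g : MvPolynomial (Fin (n + 1)) L) (c : L)
    (hc : ∀ y : Fin (n + 1) → L, Function.Injective y → pathSym y g = c) :
    pathSym x ((X (Fin.last n).castSucc - X (Fin.last n).succ) * rename Fin.castSucc g) =
      (n + 2) * c := by
  rw [pathSym_sub_mul hx]
  have hprod : ∀ π : Equiv.Perm (Fin (n + 2)),
      ∏ i ∈ Finset.univ.erase (Fin.last n), (x (π i.castSucc) - x (π i.succ)) =
      ∏ i : Fin n, (x (π i.castSucc.castSucc) - x (π i.succ.castSucc)) := by
    intro π
    have : Finset.univ.erase (Fin.last n) = Finset.univ.map Fin.castSuccEmb := by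
      ext i
      refine Fin.lastCases ?_ (fun j => ?_) i
      · simp [Fin.castSucc_ne_last]
      · simp [Fin.castSucc_ne_last]
    rw [this, Finset.prod_map]
    rfl
  simp only [hprod, eval_rename]
  have h := card_mul_sum_eq (Finset.univ : Finset (Equiv.Perm (Fin (n + 1))))
    (fun σ => σ.viaFintypeEmbedding Fin.castSuccEmb)
    fun π : Equiv.Perm (Fin (n + 2)) => eval ((x ∘ π) ∘ Fin.castSucc) g /
      ∏ i : Fin n, (x (π i.castSucc.castSucc) - x (π i.succ.castSucc))
  have hinner : ∀ π : Equiv.Perm (Fin (n + 2)), ∑ σ : Equiv.Perm (Fin (n + 1)),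
      eval ((x ∘ (π * σ.viaFintypeEmbedding Fin.castSuccEmb :
        Equiv.Perm (Fin (n + 2)))) ∘ Fin.castSucc) g /
      ∏ i : Fin n, (x ((π * σ.viaFintypeEmbedding Fin.castSuccEmb :
        Equiv.Perm (Fin (n + 2))) i.castSucc.castSucc) -
        x ((π * σ.viaFintypeEmbedding Fin.castSuccEmb :
        Equiv.Perm (Fin (n + 2))) i.succ.castSucc)) = c := by
    intro π
    have hy : Function.Injective (fun i : Fin (n + 1) => x (π i.castSucc)) :=
      hx.comp (π.injective.comp (Fin.castSucc_injective _))
    rw [← hc _ hy, pathSym_apply]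
    refine Finset.sum_congr rfl fun σ _ => ?_
    have happ : ∀ i : Fin (n + 1),
        σ.viaFintypeEmbedding Fin.castSuccEmb i.castSucc = (σ i).castSucc :=
      fun i => Equiv.Perm.viaFintypeEmbedding_apply_image σ Fin.castSuccEmb i
    simp only [Equiv.Perm.mul_apply, happ]
    congr 3
    funext i
    simp [happ]
  simp only [hinner, Finset.sum_const, Finset.card_univ, Fintype.card_perm, Fintype.card_fin,
    nsmul_eq_mul] at h
  have hfac : ((n + 1).factorial : L) ≠ 0 := Nat.cast_ne_zero.mpr (Nat.factorial_ne_zero _)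
  apply mul_left_cancel₀ hfac
  rw [h, Nat.factorial_succ (n + 1)]
  push_cast
  ring

lemma totalDegree_prod_sumFirst_le (m n : ℕ) :
    (∏ j ∈ Finset.range n, sumFirst m L (j + 1)).totalDegree ≤ n :=
  (totalDegree_finsetProd _ _).trans <|
    (Finset.sum_le_sum fun j _ => totalDegree_sumFirst_le m (j + 1)).trans (by simp)

/-- A sequence vanishing at `0` whose second differences vanish is linear. -/
lemma eq_mul_of_second_difference_eq_zero {a : ℕ → L} {n : ℕ} (h0 : a 0 = 0)
    (h : ∀ j < n, 2 * a (j + 1) = a j + a (j + 2)) : ∀ j ≤ n + 1, a j = j * a 1 := by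
  intro j
  induction j using Nat.strong_induction_on with
  | _ j ih =>
    intro hj
    match j with
    | 0 => simp [h0]
    | 1 => simp
    | j + 2 =>
      have h1 := ih j (by omega) (by omega)
      have h2 := ih (j + 1) (by omega) (by omega)
      have h3 := h j (by omega)
      push_cast at h2 ⊢
      linear_combination 2 * h2 - h1 - h3

lemma two_mul_sumFirst {n : ℕ} (k : Fin n) :
    2 * sumFirst (n + 1) L (k + 1) - sumFirst (n + 1) L k - sumFirst (n + 1) L (k + 2) =
      X k.castSucc - X k.succ := by
  have h1 := sumFirst_succ (L := L) (m := n + 1) (j := k) (by omega)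
  have h2 := sumFirst_succ (L := L) (m := n + 1) (j := k + 1) (by omega)
  change _ = _ + X k.castSucc at h1
  change _ = _ + X k.succ at h2
  linear_combination h1 - h2

theorem pathSym_prod_sumFirst [CharZero L] (n : ℕ) : ∀ x : Fin (n + 1) → L,
    Function.Injective x →
    pathSym x (∏ j ∈ Finset.range n, sumFirst (n + 1) L (j + 1)) = n.factorial := by
  induction n with
  | zero => intro x _; simp [pathSym_apply]
  | succ n ih =>
    intro x hx
    set W := ∏ j ∈ Finset.range n, sumFirst (n + 2) L (j + 1) with hW
    have hWdeg : W.totalDegree ≤ n := totalDegree_prod_sumFirst_le _ _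
    set a : ℕ → L := fun j => pathSym x (sumFirst (n + 2) L j * W) with ha
    have hdiff : ∀ k : Fin (n + 1), 2 * a (k + 1) - a k - a (k + 2) =
        pathSym x ((X k.castSucc - X k.succ) * W) := by
      intro k
      rw [← two_mul_sumFirst, sub_mul, sub_mul, map_sub, map_sub, mul_assoc, two_mul (_ * W),
        map_add, ← two_mul]
    have hlin := eq_mul_of_second_difference_eq_zero (a := a) (n := n)
      (by simp [ha, sumFirst_zero]) (by
        intro j hj
        have h1 := hdiff ⟨j, by omega⟩
        rw [hW, ← Finset.mul_prod_erase _ _ (Finset.mem_range.mpr hj),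
          pathSym_sub_mul_sumFirst_mul hx ⟨j, by omega⟩] at h1
        · linear_combination h1
        · have h2 : (∏ i ∈ (Finset.range n).erase j, sumFirst (n + 2) L (i + 1)).totalDegree ≤
              n - 1 := by
            refine (totalDegree_finsetProd _ _).trans
              ((Finset.sum_le_sum fun i _ => totalDegree_sumFirst_le _ (i + 1)).trans ?_)
            simp [Finset.card_erase_of_mem (Finset.mem_range.mpr hj)]
          omega)
    have htop : a (n + 2) = 0 := pathSym_sumFirst_last_mul hx (by omega)
    have hWren : W = rename Fin.castSucc
        (∏ j ∈ Finset.range n, sumFirst (n + 1) L (j + 1)) := by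
      rw [hW, map_prod]
      refine Finset.prod_congr rfl fun j hj => (rename_castSucc_sumFirst ?_).symm
      have := Finset.mem_range.mp hj
      omega
    have hlast := hdiff (Fin.last n)
    rw [hWren, pathSym_sub_last_mul_rename hx _ _ ih, Fin.val_last, htop] at hlast
    have h1 := hlin n (by omega)
    have h2 := hlin (n + 1) le_rfl
    rw [Finset.prod_range_succ, mul_comm]
    change a (n + 1) = _
    have hne : (n + 2 : L) ≠ 0 := by exact_mod_cast (Nat.succ_ne_zero (n + 1))
    apply mul_left_cancel₀ hne
    rw [Nat.factorial_succ]
    push_cast at h2 ⊢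
    linear_combination (n + 2 : L) * h2 + (n + 1 : L) * (hlast + h1 - 2 * h2)

/-- The monomial `Π y_i^{c_i}` in the partial sums `y_i = x_0 + ⋯ + x_i`. -/
noncomputable def sumFirstMonomial (L : Type*) [Field L] {n : ℕ} (c : Fin (n + 1) → ℕ) :
    MvPolynomial (Fin (n + 1)) L :=
  ∏ i : Fin (n + 1), sumFirst (n + 1) L (i + 1) ^ c i

lemma sumFirstMonomial_add_single {n : ℕ} (c : Fin (n + 1) → ℕ) (k : Fin (n + 1)) :
    sumFirstMonomial L (c + Pi.single k 1) =
      sumFirst (n + 1) L (k + 1) * sumFirstMonomial L c := by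
  simp only [sumFirstMonomial, Pi.add_apply, pow_add, Finset.prod_mul_distrib]
  rw [mul_comm, Fintype.prod_eq_single k fun i hi => by simp [hi], Pi.single_eq_same, pow_one]

lemma totalDegree_sumFirstMonomial_le {n : ℕ} (c : Fin (n + 1) → ℕ) :
    (sumFirstMonomial L c).totalDegree ≤ ∑ i, c i := by
  refine (totalDegree_finsetProd _ _).trans (Finset.sum_le_sum fun i _ => ?_)
  exact (totalDegree_pow _ _).trans
    ((Nat.mul_le_mul_left _ (totalDegree_sumFirst_le _ _)).trans (mul_one _).le)

lemma exists_eq_add_single {n : ℕ} {c : Fin (n + 1) → ℕ} {k : Fin (n + 1)} (hk : 0 < c k) :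
    ∃ d : Fin (n + 1) → ℕ, c = d + Pi.single k 1 ∧ ∑ i, d i + 1 = ∑ i, c i := by
  have h : c = (c - Pi.single k 1) + Pi.single k 1 := by
    ext i
    by_cases hi : i = k
    · subst hi
      simp only [Pi.add_apply, Pi.sub_apply, Pi.single_eq_same]
      omega
    · simp [hi]
  refine ⟨_, h, ?_⟩
  conv_rhs => rw [h]
  simp [Finset.sum_add_distrib]

lemma pathSym_sumFirstMonomial_eq_zero [CharZero L] {n : ℕ} {x : Fin (n + 1) → L}
    (hx : Function.Injective x) {c : Fin (n + 1) → ℕ} (hc : ∑ i, c i = n)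
    (hlast : 0 < c (Fin.last n)) : pathSym x (sumFirstMonomial L c) = 0 := by
  obtain ⟨d, rfl, hd⟩ := exists_eq_add_single hlast
  rw [sumFirstMonomial_add_single, Fin.val_last]
  have := totalDegree_sumFirstMonomial_le (L := L) d
  exact pathSym_sumFirst_last_mul hx (by omega)

lemma two_mul_pathSym_sumFirstMonomial [CharZero L] {n : ℕ} {x : Fin (n + 1) → L}
    (hx : Function.Injective x) {c : Fin (n + 1) → ℕ} (hc : ∑ i, c i + 1 = n)
    {k : Fin (n + 1)} (hk : 0 < c k) :
    2 * pathSym x (sumFirstMonomial L (c + Pi.single k 1)) =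
      pathSym x (sumFirstMonomial L (c + Pi.single (k - 1) 1)) +
        pathSym x (sumFirstMonomial L (c + Pi.single (k + 1) 1)) := by
  have hsum : ∀ j : Fin (n + 1), ∑ i, (c + Pi.single j 1 : Fin (n + 1) → ℕ) i = n := by
    intro j
    simp [Finset.sum_add_distrib, hc]
  induction k using Fin.lastCases with
  | last =>
    have hzero : ∀ j, pathSym x (sumFirstMonomial L (c + Pi.single j 1)) = 0 := fun j =>
      pathSym_sumFirstMonomial_eq_zero hx (hsum j) (Nat.add_pos_left hk _)
    simp [hzero]
  | cast k =>
    have hprev : pathSym x (sumFirstMonomial L (c + Pi.single (k.castSucc - 1) 1)) =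
        pathSym x (sumFirst (n + 1) L k * sumFirstMonomial L c) := by
      by_cases h0 : k.castSucc = 0
      · have hk0 : k.val = 0 := by simpa using congrArg Fin.val h0
        rw [hk0, sumFirst_zero, zero_mul, map_zero]
        refine pathSym_sumFirstMonomial_eq_zero hx (hsum _) ?_
        have : k.castSucc - 1 = Fin.last n := by
          rw [h0]
          ext
          simp
        simp [this]
      · have hval : (k.castSucc - 1).val + 1 = k.val := by
          have hk0 : k.val ≠ 0 := fun h => h0 (Fin.ext h)
          rw [Fin.coe_sub_one, if_neg h0, Fin.val_castSucc]
          omega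
        rw [sumFirstMonomial_add_single, hval]
    have hcut : pathSym x ((X k.castSucc - X k.succ) * sumFirstMonomial L c) = 0 := by
      obtain ⟨d, rfl, hd⟩ := exists_eq_add_single hk
      rw [sumFirstMonomial_add_single]
      have := totalDegree_sumFirstMonomial_le (L := L) d
      exact pathSym_sub_mul_sumFirst_mul hx k (by omega)
    rw [hprev, Fin.coeSucc_eq_succ, sumFirstMonomial_add_single, sumFirstMonomial_add_single]
    rw [← two_mul_sumFirst, sub_mul, sub_mul, map_sub, map_sub, mul_assoc,
      two_mul (_ * sumFirstMonomial L c), map_add, ← two_mul] at hcut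
    simp only [Fin.val_castSucc, Fin.val_succ]
    linear_combination hcut

end PathSym

section Bridge

variable {K : Type*} [Field K]

lemma injective_algebraMap_X (m : ℕ) : Function.Injective fun i : Fin m =>
    algebraMap (MvPolynomial (Fin m) K) (FractionRing (MvPolynomial (Fin m) K)) (X i) :=
  (IsFractionRing.injective _ _).comp (X_injective)

lemma algebraMap_rename {m : ℕ} (π : Fin m → Fin m) (f : MvPolynomial (Fin m) K) :
    algebraMap (MvPolynomial (Fin m) K) (FractionRing (MvPolynomial (Fin m) K)) (rename π f) =
      eval ((fun i => algebraMap (MvPolynomial (Fin m) K)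
          (FractionRing (MvPolynomial (Fin m) K)) (X i)) ∘ π)
        (map ((algebraMap (MvPolynomial (Fin m) K)
          (FractionRing (MvPolynomial (Fin m) K))).comp C) f) := by
  induction f using MvPolynomial.induction_on with
  | C a => simp
  | add p q hp hq => simp only [map_add, hp, hq]
  | mul_X p i hp => simp only [map_mul, hp, rename_X, map_X, eval_X, Function.comp_apply]

lemma DS_pathEdges_prod_pathY {n : ℕ} (c : Fin (n + 1) → ℕ) :
    DS (pathEdges n) (∏ i : Fin (n + 1), pathY n K i ^ c i) =
      pathSym (fun i => algebraMap (MvPolynomial (Fin (n + 1)) K)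
        (FractionRing (MvPolynomial (Fin (n + 1)) K)) (X i))
        (sumFirstMonomial (FractionRing (MvPolynomial (Fin (n + 1)) K)) c) := by
  rw [pathSym_apply, DS]
  refine Finset.sum_congr rfl fun π _ => ?_
  congr 1
  · rw [algebraMap_rename]
    congr 1
    simp only [sumFirstMonomial, map_prod, map_pow, pathY, sumFirst, map_sum, map_X]
    refine Finset.prod_congr rfl fun i _ =>
      congrArg (· ^ c i) (Finset.sum_congr (Finset.ext fun j => ?_) fun _ _ => rfl)
    simp only [Finset.mem_Iic, Finset.mem_filter, Finset.mem_univ, true_and, Fin.le_def,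
      Nat.lt_succ_iff]
  · rw [pathEdges, Finset.prod_image fun i _ j _ h =>
      Fin.castSucc_injective _ (Prod.ext_iff.mp h).1]
    simp

end Bridge

/-- for the path `G` on `x_0, …, x_n`, `Φ = DS_G`, and
`y_i = x_0 + ⋯ + x_i`, the function `P(c_0, …, c_n) := Φ(Π_{i=0}^{n} y_i^{c_i}) / n!`
on the `(n+1)`-tuples of nonnegative integers with `Σ c_i = n` satisfies:
(i) `P(1, 1, …, 1, 0) = 1`; (ii) `P(c) = 0` whenever `c_n > 0`; and (iii) for every
tuple `c` and index `k` (mod `n + 1`) with `c_k ≥ 2`,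
`2·P(c) = P(c_{k−1} += 1, c_k −= 1) + P(c_k −= 1, c_{k+1} += 1)`. -/
theorem divided_symmetrization_sandpile_properties {K : Type*} [Field K] [CharZero K]
    (n : ℕ) :
    (DS (pathEdges n)
        (∏ i : Fin (n + 1), pathY n K i ^ (if i = Fin.last n then 0 else 1)) /
        (n.factorial : FractionRing (MvPolynomial (Fin (n + 1)) K)) = 1) ∧
    (∀ c : Fin (n + 1) → ℕ, (∑ j, c j) = n → 0 < c (Fin.last n) →
      DS (pathEdges n) (∏ i : Fin (n + 1), pathY n K i ^ c i) /
        (n.factorial : FractionRing (MvPolynomial (Fin (n + 1)) K)) = 0) ∧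
    (∀ c : Fin (n + 1) → ℕ, (∑ j, c j) = n → ∀ k : Fin (n + 1), 2 ≤ c k →
      2 * (DS (pathEdges n) (∏ i : Fin (n + 1), pathY n K i ^ c i) /
            (n.factorial : FractionRing (MvPolynomial (Fin (n + 1)) K))) =
        DS (pathEdges n) (∏ i : Fin (n + 1), pathY n K i ^
              (if i = k then c k - 1 else if i = k - 1 then c i + 1 else c i)) /
            (n.factorial : FractionRing (MvPolynomial (Fin (n + 1)) K)) +
          DS (pathEdges n) (∏ i : Fin (n + 1), pathY n K i ^
              (if i = k then c k - 1 else if i = k + 1 then c i + 1 else c i)) /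
            (n.factorial : FractionRing (MvPolynomial (Fin (n + 1)) K))) := by
  set x : Fin (n + 1) → FractionRing (MvPolynomial (Fin (n + 1)) K) :=
    fun i => algebraMap (MvPolynomial (Fin (n + 1)) K)
      (FractionRing (MvPolynomial (Fin (n + 1)) K)) (X i) with hx_def
  have hx : Function.Injective x := injective_algebraMap_X (n + 1)
  have hchar : CharZero (FractionRing (MvPolynomial (Fin (n + 1)) K)) :=
    charZero_of_injective_algebraMap (IsFractionRing.injective (MvPolynomial (Fin (n + 1)) K) _)
  have hfac : (n.factorial : FractionRing (MvPolynomial (Fin (n + 1)) K)) ≠ 0 :=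
    Nat.cast_ne_zero.mpr n.factorial_ne_zero
  refine ⟨?_, ?_, ?_⟩
  · rw [DS_pathEdges_prod_pathY, div_eq_one_iff_eq hfac, ← pathSym_prod_sumFirst n x hx,
      sumFirstMonomial, Fin.prod_univ_castSucc, Finset.prod_range]
    simp [Fin.castSucc_ne_last, hx_def]
  · intro c hc hlast
    rw [DS_pathEdges_prod_pathY, pathSym_sumFirstMonomial_eq_zero hx hc hlast, zero_div]
  · intro c hc k hk
    have hn : 1 < n + 1 := by
      have := Finset.single_le_sum (f := c) (fun i _ => Nat.zero_le _) (Finset.mem_univ k)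
      omega
    have hone : (1 : Fin (n + 1)) ≠ 0 := by
      have : NeZero n := ⟨by omega⟩
      exact one_ne_zero
    obtain ⟨d, rfl, hd⟩ := exists_eq_add_single (by omega : 0 < c k)
    have hdk : 0 < d k := by
      simp only [Pi.add_apply, Pi.single_eq_same] at hk
      omega
    have hshift : ∀ l, l ≠ k → (fun i => if i = k then (d + Pi.single k 1 : Fin (n + 1) → ℕ) k - 1
        else if i = l then (d + Pi.single k 1 : Fin (n + 1) → ℕ) i + 1
        else (d + Pi.single k 1 : Fin (n + 1) → ℕ) i) = d + Pi.single l 1 := by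
      intro l hl
      ext i
      by_cases hik : i = k
      · subst hik
        simp [hl.symm]
      · by_cases hil : i = l
        · subst hil
          simp [hik]
        · simp [hik, hil]
    rw [DS_pathEdges_prod_pathY, DS_pathEdges_prod_pathY, DS_pathEdges_prod_pathY,
      hshift (k - 1) (by simpa using hone), hshift (k + 1) (by simpa using hone)]
    rw [← mul_div_assoc, two_mul_pathSym_sumFirstMonomial hx (by omega) hdk, add_div]
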